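/- Let d be a prime and let c_0 ∈ ℂ be a root of the Gleason polynomial G_{d,n} for some n ≥ 2. Set K = ℚ(c_0). For any k ≥ 1, write k = nq + r with q ≥ 0 and 0 ≤ r < n. Then over K one has the factorization f_{d,c_0}^k = (∏_{j=0}^{q−1} ∏_{i=1}^{n−1} (F_{k−nj−i, n−i}^{(d,c_0)})^{d^j}) · ((x − a_{n−r}(c_0)) ∏_{i=1}^{r} F_{r−i, n−i}^{(d,c_0)})^{d^q}, and moreover the polynomials F_{a,b}^{(d,c_0)} appearing in this product are pairwise distinct and each is irreducible over K. -/

import Mathlib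

open Polynomial IntermediateField

noncomputable section

/-- The value sequence `a_i(c)`: `a_0 = 0`, `a_{i+1} = a_i ^ d + c`. -/
def aSeq (d : ℕ) {F : Type*} [CommRing F] (c : F) : ℕ → F
  | 0 => 0
  | i + 1 => aSeq d c i ^ d + c

/-- The polynomials `a_i ∈ ℤ[c]`: `a_0 = 0`, `a_{i+1} = a_i ^ d + c`. -/
def aPoly (d : ℕ) : ℕ → Polynomial ℤ
  | 0 => 0
  | i + 1 => aPoly d i ^ d + X

/-- Iterates of `f_{d,c} = x^d + c`: `f^0 = x`, `f^{k+1} = f ∘ f^k`. -/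
def fIter (d : ℕ) {F : Type*} [CommRing F] (c : F) : ℕ → Polynomial F
  | 0 => X
  | k + 1 => fIter d c k ^ d + C c

/-- `c₀` is a root of the Gleason polynomial `G_{d,n} = ∏_{k ∣ n} a_k^{μ(n/k)}`. -/
def isGleasonRoot (d n : ℕ) (c₀ : ℂ) : Prop :=
  ∃ g : Polynomial ℤ,
    g * ∏ k ∈ n.divisors, aPoly d k ^ ((-(ArithmeticFunction.moebius (n / k))).toNat)
        = ∏ k ∈ n.divisors, aPoly d k ^ ((ArithmeticFunction.moebius (n / k)).toNat)
    ∧ Polynomial.aeval c₀ g = 0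

/-- `c₀` is a root of the Misiurewicz polynomial `G_{d,m,n}^ζ`. -/
def isMisiurewiczRoot (d m n : ℕ) (ζ c₀ : ℂ) : Prop :=
  ∃ g : Polynomial ℂ,
    g * ((∏ k ∈ n.divisors,
            ((aPoly d (m + k - 1)).map (Int.castRingHom ℂ) -
              C ζ * (aPoly d (m - 1)).map (Int.castRingHom ℂ))
                ^ ((-(ArithmeticFunction.moebius (n / k))).toNat)) *
          (if n ∣ (m - 1) then
            ∏ k ∈ n.divisors, ((aPoly d k).map (Int.castRingHom ℂ))
                ^ ((ArithmeticFunction.moebius (n / k)).toNat)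
          else 1))
        = (∏ k ∈ n.divisors,
            ((aPoly d (m + k - 1)).map (Int.castRingHom ℂ) -
              C ζ * (aPoly d (m - 1)).map (Int.castRingHom ℂ))
                ^ ((ArithmeticFunction.moebius (n / k)).toNat)) *
          (if n ∣ (m - 1) then
            ∏ k ∈ n.divisors, ((aPoly d k).map (Int.castRingHom ℂ))
                ^ ((-(ArithmeticFunction.moebius (n / k))).toNat)
          else 1)
    ∧ g.eval c₀ = 0

/-- The polynomial `F_{k,i}^{(d,c₀)} = ∏_{j=1}^{d-1} (f_{d,c₀}^k - ζ^j a_i(c₀))` over `ℂ`. -/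
def FPoly (d : ℕ) (c₀ ζ : ℂ) (k i : ℕ) : Polynomial ℂ :=
  ∏ j ∈ Finset.Icc 1 (d - 1), (fIter d c₀ k - C (ζ ^ j * aSeq d c₀ i))


section Values

variable {d : ℕ} {R S : Type*} [CommRing R] [CommRing S]

lemma map_aSeq (φ : R →+* S) (c : R) (i : ℕ) : φ (aSeq d c i) = aSeq d (φ c) i := by
  induction i with
  | zero => simp [aSeq]
  | succ i ih => simp [aSeq, ih]

lemma aPoly_eq_aSeq (i : ℕ) : aPoly d i = aSeq d (X : ℤ[X]) i := by
  induction i with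
  | zero => rfl
  | succ i ih => simp [aSeq, aPoly, ih]

lemma aeval_aPoly (c : R) (i : ℕ) : aeval c (aPoly d i) = aSeq d c i := by
  rw [aPoly_eq_aSeq]
  simpa using map_aSeq (d := d) (aeval (R := ℤ) c).toRingHom X i

lemma aSeq_eq_iterate (c : R) (i : ℕ) : aSeq d c i = (fun x => x ^ d + c)^[i] 0 := by
  induction i with
  | zero => rfl
  | succ i ih => rw [Function.iterate_succ_apply', ← ih, aSeq]

lemma isPeriodicPt_zero_iff (c : R) (i : ℕ) :
    Function.IsPeriodicPt (fun x => x ^ d + c) i 0 ↔ aSeq d c i = 0 := by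
  rw [aSeq_eq_iterate]; rfl

lemma aSeq_add_mul {c : R} {n : ℕ} (h : aSeq d c n = 0) (i m : ℕ) :
    aSeq d c (i + n * m) = aSeq d c i := by
  have := ((isPeriodicPt_zero_iff c n).2 h).mul_const m
  rw [aSeq_eq_iterate, aSeq_eq_iterate, Function.iterate_add_apply, this]

lemma aPoly_dvd {m n : ℕ} (h : m ∣ n) : aPoly d m ∣ aPoly d n := by
  rw [aPoly_eq_aSeq, aPoly_eq_aSeq, ← Ideal.mem_span_singleton, ← Ideal.Quotient.eq_zero_iff_mem,
    map_aSeq, ← isPeriodicPt_zero_iff]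
  refine Function.IsPeriodicPt.trans_dvd ?_ h
  rw [isPeriodicPt_zero_iff, ← map_aSeq, Ideal.Quotient.eq_zero_iff_mem]
  exact Ideal.mem_span_singleton_self _

lemma aPoly_derivative {n : ℕ} (hn : 0 < n) :
    ∃ s : ℤ[X], derivative (aPoly d n) = 1 + (d : ℤ[X]) * s := by
  obtain ⟨n, rfl⟩ := Nat.exists_eq_succ_of_ne_zero hn.ne'
  refine ⟨aPoly d n ^ (d - 1) * derivative (aPoly d n), ?_⟩
  simp [aPoly, derivative_pow]
  ring

lemma aPoly_monic_natDegree (hd : 2 ≤ d) (n : ℕ) :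
    (aPoly d (n + 1)).Monic ∧ (aPoly d (n + 1)).natDegree = d ^ n := by
  induction n with
  | zero => simp [aPoly, show d ≠ 0 by omega, monic_X]
  | succ n ih =>
    have hdeg : (aPoly d (n + 1) ^ d).natDegree = d ^ (n + 1) := by
      rw [ih.1.natDegree_pow, ih.2, pow_succ, mul_comm]
    have hlt : (X : ℤ[X]).natDegree < (aPoly d (n + 1) ^ d).natDegree := by
      rw [hdeg, natDegree_X]
      exact Nat.one_lt_pow (by omega) (by omega)
    rw [aPoly]
    exact ⟨(ih.1.pow d).add_of_left (degree_lt_degree hlt),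
      by rw [natDegree_add_eq_left_of_natDegree_lt hlt, hdeg]⟩

lemma aPoly_monic (hd : 2 ≤ d) {n : ℕ} (hn : 0 < n) : (aPoly d n).Monic := by
  obtain ⟨n, rfl⟩ := Nat.exists_eq_succ_of_ne_zero hn.ne'
  exact (aPoly_monic_natDegree hd n).1

end Values

section Iterates

variable {d : ℕ} {R S : Type*} [CommRing R] [CommRing S]

lemma map_fIter (φ : R →+* S) (c : R) (k : ℕ) :
    (fIter d c k).map φ = fIter d (φ c) k := by
  induction k with
  | zero => simp [fIter]
  | succ k ih => simp [fIter, ih]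

lemma eval_aSeq_fIter (c : R) (j k : ℕ) : (fIter d c k).eval (aSeq d c j) = aSeq d c (j + k) := by
  induction k with
  | zero => simp [fIter]
  | succ k ih => simp [fIter, ih, aSeq]

lemma fIter_monic_natDegree [Nontrivial R] (hd : 0 < d) (c : R) (k : ℕ) :
    (fIter d c k).Monic ∧ (fIter d c k).natDegree = d ^ k := by
  induction k with
  | zero => simp [fIter, monic_X]
  | succ k ih =>
    have hdeg : (fIter d c k ^ d).natDegree = d ^ (k + 1) := by
      rw [ih.1.natDegree_pow, ih.2, pow_succ, mul_comm]
    have hlt : (C c).natDegree < (fIter d c k ^ d).natDegree := by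
      rw [hdeg, natDegree_C]
      positivity
    rw [fIter]
    exact ⟨(ih.1.pow d).add_of_left (degree_lt_degree hlt),
      by rw [natDegree_add_eq_left_of_natDegree_lt hlt, hdeg]⟩

lemma fIter_sub_C_monic_natDegree [Nontrivial R] (hd : 0 < d) (c a : R) (k : ℕ) :
    (fIter d c k - C a).Monic ∧ (fIter d c k - C a).natDegree = d ^ k := by
  obtain ⟨hm, hdeg⟩ := fIter_monic_natDegree hd c k
  have hlt : (C a).natDegree < (fIter d c k).natDegree := by
    rw [hdeg, natDegree_C]
    positivity
  exact ⟨hm.sub_of_left (degree_lt_degree hlt),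
    by rw [natDegree_sub_eq_left_of_natDegree_lt hlt, hdeg]⟩

lemma fIter_sub_C_eq_pow [hd : Fact d.Prime] [CharP R d] (c : R) (j k : ℕ) :
    fIter d c k - C (aSeq d c (j + k)) = (X - C (aSeq d c j)) ^ d ^ k := by
  induction k with
  | zero => simp [fIter]
  | succ k ih =>
    rw [pow_succ, pow_mul, ← ih, sub_pow_char, fIter, ← add_assoc, aSeq]
    simp

/-- The quotient `(f^{k+1} - a_{i+1}) / (f^k - a_i)`, over an arbitrary base ring. -/
def iterateQuotient (d : ℕ) (c : R) (k i : ℕ) : R[X] :=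
  ∑ s ∈ Finset.range d, fIter d c k ^ s * C (aSeq d c i) ^ (d - 1 - s)

lemma map_iterateQuotient (φ : R →+* S) (c : R) (k i : ℕ) :
    (iterateQuotient d c k i).map φ = iterateQuotient d (φ c) k i := by
  simp [iterateQuotient, Polynomial.map_sum, map_fIter, map_aSeq φ]

lemma iterateQuotient_mul (c : R) (k i : ℕ) :
    iterateQuotient d c k i * (fIter d c k - C (aSeq d c i)) =
      fIter d c (k + 1) - C (aSeq d c (i + 1)) := by
  rw [iterateQuotient, (Commute.all _ _).geom_sum₂_mul, fIter, aSeq]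
  simp

lemma iterateQuotient_monic_natDegree [Nontrivial R] (hd : 0 < d) (c : R) (k i : ℕ) :
    (iterateQuotient d c k i).Monic ∧
      (iterateQuotient d c k i).natDegree = (d - 1) * d ^ k := by
  have h1 := fIter_sub_C_monic_natDegree hd c (aSeq d c i) k
  have h2 := fIter_sub_C_monic_natDegree hd c (aSeq d c (i + 1)) (k + 1)
  rw [← iterateQuotient_mul] at h2
  have hm : (iterateQuotient d c k i).Monic := h1.1.of_mul_monic_right h2.1
  refine ⟨hm, ?_⟩
  have := h2.2
  rw [hm.natDegree_mul h1.1, h1.2, pow_succ] at this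
  obtain ⟨e, rfl⟩ := Nat.exists_eq_succ_of_ne_zero hd.ne'
  simp only [Nat.succ_eq_add_one, Nat.add_sub_cancel] at *
  linarith

lemma fIter_sub_C_eq_prod (c : R) (k m r : ℕ) (hk : r ≤ k) (hm : r ≤ m) :
    fIter d c k - C (aSeq d c m) =
      (∏ i ∈ Finset.Icc 1 r, iterateQuotient d c (k - i) (m - i)) *
        (fIter d c (k - r) - C (aSeq d c (m - r))) := by
  induction r with
  | zero => simp
  | succ r ih =>
    rw [ih (by omega) (by omega), Finset.prod_Icc_succ_top (by omega), mul_assoc,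
      iterateQuotient_mul]
    congr 3 <;> congr 2 <;> omega

lemma iterateQuotient_eq_pow [IsDomain R] [hd : Fact d.Prime] [CharP R d] (c : R) (j k i : ℕ)
    (h : aSeq d c (j + k) = aSeq d c i) :
    iterateQuotient d c k i = (X - C (aSeq d c j)) ^ ((d - 1) * d ^ k) := by
  have hne := (fIter_sub_C_monic_natDegree hd.out.pos c (aSeq d c i) k).1.ne_zero
  apply mul_right_cancel₀ hne
  rw [iterateQuotient_mul, aSeq, ← h]
  have := fIter_sub_C_eq_pow c j (k + 1)
  rw [← add_assoc, aSeq] at this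
  rw [this, fIter_sub_C_eq_pow, ← pow_add, pow_succ]
  congr 1
  obtain ⟨e, he⟩ := Nat.exists_eq_succ_of_ne_zero hd.out.ne_zero
  generalize d ^ k = D
  subst he
  simp
  ring

lemma iterateQuotient_irreducible [IsDomain R] [hd : Fact d.Prime] {P : Ideal R} [hP : P.IsMaximal]
    (hdP : (d : R) ∈ P) (hdP2 : (d : R) ∉ P ^ 2) {c : R} {n i : ℕ} (hn : 0 < n)
    (hc : aSeq d c n = 0) (hi : aSeq d c i ∉ P) (k : ℕ) :
    Irreducible (iterateQuotient d c k i) := by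
  let _ := Ideal.Quotient.field P
  have : CharP (R ⧸ P) d := by
    have h0 : (d : R ⧸ P) = 0 := by
      rw [← map_natCast (Ideal.Quotient.mk P), Ideal.Quotient.eq_zero_iff_mem]
      exact hdP
    exact (CharP.charP_iff_prime_eq_zero hd.out).2 h0
  set j := i + n * k - k with hj
  have hjk : j + k = i + n * k := by
    have : k ≤ n * k := Nat.le_mul_of_pos_left k hn
    omega
  have haj : aSeq d c (j + k) = aSeq d c i := by rw [hjk, aSeq_add_mul hc]
  obtain ⟨hm, hdeg⟩ := iterateQuotient_monic_natDegree hd.out.pos c k i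
  refine generalizedEisenstein (K := R ⧸ P) (q := X - C (aSeq d c j)) (p := (d - 1) * d ^ k)
    ?_ (monic_X_sub_C _) hm.isPrimitive ?_ ?_ ?_ ?_
  · simpa using irreducible_X_sub_C _
  · rw [hdeg]
    have := hd.out.two_le
    exact Nat.mul_pos (by omega) (by positivity)
  · simp [hm.leadingCoeff]
  · rw [map_iterateQuotient, iterateQuotient_eq_pow _ j]
    · simp [hm.leadingCoeff, map_aSeq (Ideal.Quotient.mk P)]
    · rw [← map_aSeq, ← map_aSeq, haj]
  · rw [modByMonic_X_sub_C_eq_C_eval, map_C, Ne, C_eq_zero, Ideal.Quotient.eq_zero_iff_mem,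
      Ideal.Quotient.algebraMap_eq, Ideal.mk_ker, iterateQuotient, eval_finsetSum]
    simp only [eval_mul, eval_pow, eval_aSeq_fIter, haj, eval_C]
    have : ∑ s ∈ Finset.range d, aSeq d c i ^ s * aSeq d c i ^ (d - 1 - s) =
        (d : R) * aSeq d c i ^ (d - 1) := by
      rw [Finset.sum_congr rfl (g := fun _ => aSeq d c i ^ (d - 1))]
      · simp
      · intro s hs
        rw [← pow_add]
        congr 1
        have := Finset.mem_range.1 hs
        omega
    rw [this, mul_comm]
    intro h
    rcases Ideal.IsMaximal.mul_mem_pow P h with h | h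
    · exact hi (hP.isPrime.mem_of_pow_mem _ h)
    · exact hdP2 h

end Iterates
section Gleason

lemma rootMultiplicity_prod_pow {ι R : Type*} [CommRing R] [IsDomain R] (s : Finset ι)
    (f : ι → R[X]) (e : ι → ℕ) (hf : ∀ i ∈ s, f i ≠ 0) (x : R) :
    rootMultiplicity x (∏ i ∈ s, f i ^ e i) = ∑ i ∈ s, e i * rootMultiplicity x (f i) := by
  classical
  have hne : ∏ i ∈ s, f i ^ e i ≠ 0 := Finset.prod_ne_zero_iff.2 fun i hi => pow_ne_zero _ (hf i hi)
  rw [← count_roots, roots_prod _ _ hne, Multiset.count_bind]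
  simp only [roots_pow, Multiset.count_nsmul, count_roots]
  rfl

variable {d : ℕ}

lemma derivative_aPoly_aeval_ne_zero (hd : 2 ≤ d) {n : ℕ} (hn : 0 < n) {c : ℂ}
    (hc : aSeq d c n = 0) : aeval c (derivative (aPoly d n)) ≠ 0 := by
  have hint : IsIntegral ℤ c := ⟨aPoly d n, aPoly_monic hd hn, by
    rw [← aeval_def, aeval_aPoly, hc]⟩
  obtain ⟨s, hs⟩ := aPoly_derivative (d := d) hn
  intro h
  rw [hs] at h
  simp only [map_add, map_one, map_mul, map_natCast] at h
  have hd0 : (d : ℂ) ≠ 0 := by exact_mod_cast (by omega : d ≠ 0)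
  have hsint : IsIntegral ℤ (aeval c s) := IsIntegral.of_mem_of_fg _ hint.fg_adjoin_singleton _
    (aeval_mem_adjoin_singleton _ _)
  have hrat : aeval c s = algebraMap ℚ ℂ (-1 / d) := by
    simp only [map_div₀, map_neg, map_one, map_natCast]
    field_simp
    linear_combination h
  rw [hrat, isIntegral_algebraMap_iff (algebraMap ℚ ℂ).injective,
    IsIntegrallyClosed.isIntegral_iff] at hsint
  obtain ⟨y, hy⟩ := hsint
  have hd0' : (d : ℚ) ≠ 0 := by exact_mod_cast (by omega : d ≠ 0)
  have hy' : (y : ℚ) * d = -1 := by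
    have : (y : ℚ) = -1 / d := by simpa using hy
    rw [this]
    field_simp
  have hy'' : y * d = -1 := by exact_mod_cast hy'
  have hdvd : (d : ℤ) ∣ 1 := ⟨-y, by linarith⟩
  have := Int.le_of_dvd one_pos hdvd
  omega

lemma rootMultiplicity_aPoly (hd : 2 ≤ d) {n : ℕ} (hn : 0 < n) (c : ℂ) :
    rootMultiplicity c ((aPoly d n).map (Int.castRingHom ℂ)) =
      if aSeq d c n = 0 then 1 else 0 := by
  have hne : (aPoly d n).map (Int.castRingHom ℂ) ≠ 0 := ((aPoly_monic hd hn).map _).ne_zero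
  have hroot : IsRoot ((aPoly d n).map (Int.castRingHom ℂ)) c ↔ aSeq d c n = 0 := by
    rw [← aeval_aPoly, IsRoot.def, eval_map, aeval_def]
    rfl
  split_ifs with h
  · apply le_antisymm
    · rw [← not_lt, one_lt_rootMultiplicity_iff_isRoot hne]
      rintro ⟨-, h2⟩
      apply derivative_aPoly_aeval_ne_zero hd hn h
      rw [derivative_map, IsRoot.def, eval_map] at h2
      rw [aeval_def]
      exact h2
    · exact (rootMultiplicity_pos hne).2 (hroot.2 h)
  · exact rootMultiplicity_eq_zero (mt hroot.1 h)

lemma sum_divisors_moebius_ite (m n : ℕ) (hn : 0 < n) :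
    ∑ k ∈ n.divisors, ArithmeticFunction.moebius (n / k) * (if m ∣ k then 1 else 0 : ℤ) =
      if n = m then 1 else 0 := by
  have := (ArithmeticFunction.sum_eq_iff_sum_mul_moebius_eq (R := ℤ)
    (f := fun i => if i = m then 1 else 0) (g := fun k => if m ∣ k then 1 else 0)).1
    (fun k hk => by simp [hk.ne']) n hn
  simp only [Int.cast_id] at this
  rw [← this, Nat.sum_divisorsAntidiagonal'
    (f := fun a b => ArithmeticFunction.moebius a * (if m ∣ b then 1 else 0 : ℤ))]

/-- A root of the Gleason polynomial of index `n` has exact period `n`. -/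
lemma minimalPeriod_of_isGleasonRoot (hd : 2 ≤ d) {n : ℕ} (hn : 0 < n) {c : ℂ}
    (hc : isGleasonRoot d n c) : Function.minimalPeriod (fun x => x ^ d + c) 0 = n := by
  obtain ⟨g, hg, hgc⟩ := hc
  have hpos : ∀ k ∈ n.divisors, 0 < k := fun k hk => Nat.pos_of_mem_divisors hk
  have hne : ∀ k ∈ n.divisors, (aPoly d k).map (Int.castRingHom ℂ) ≠ 0 := fun k hk =>
    ((aPoly_monic hd (hpos k hk)).map _).ne_zero
  have hg' := congrArg (Polynomial.map (Int.castRingHom ℂ)) hg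
  simp only [Polynomial.map_mul, Polynomial.map_prod, Polynomial.map_pow] at hg'
  have hprod : ∏ k ∈ n.divisors, (aPoly d k).map (Int.castRingHom ℂ) ^
      (ArithmeticFunction.moebius (n / k)).toNat ≠ 0 :=
    Finset.prod_ne_zero_iff.2 fun i hi => pow_ne_zero _ (hne i hi)
  have hroot : IsRoot (g.map (Int.castRingHom ℂ)) c := by
    rw [IsRoot.def, eval_map]
    exact hgc
  have hg0 : g.map (Int.castRingHom ℂ) ≠ 0 := by
    intro h
    rw [h, zero_mul] at hg'
    exact hprod hg'.symm
  have hmult := (rootMultiplicity_pos hg0).2 hroot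
  have hsum := congrArg (rootMultiplicity c) hg'
  rw [rootMultiplicity_mul (by rw [hg']; exact hprod), rootMultiplicity_prod_pow _ _ _ hne,
    rootMultiplicity_prod_pow _ _ _ hne] at hsum
  set m := Function.minimalPeriod (fun x => x ^ d + c) 0 with hm
  have hrm : ∀ k ∈ n.divisors, rootMultiplicity c ((aPoly d k).map (Int.castRingHom ℂ)) =
      if m ∣ k then 1 else 0 := fun k hk => by
    rw [rootMultiplicity_aPoly hd (hpos k hk)]
    simp only [← isPeriodicPt_zero_iff, Function.isPeriodicPt_iff_minimalPeriod_dvd, hm]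
  have key : (rootMultiplicity c (g.map (Int.castRingHom ℂ)) : ℤ) = if n = m then 1 else 0 := by
    rw [← sum_divisors_moebius_ite m n hn]
    have hsum' := congrArg (Nat.cast : ℕ → ℤ) hsum
    push_cast at hsum'
    rw [← eq_sub_iff_add_eq, ← Finset.sum_sub_distrib] at hsum'
    rw [hsum']
    refine Finset.sum_congr rfl fun k hk => ?_
    rw [hrm k hk, ← sub_mul]
    congr 1
    · omega
    · push_cast; rfl
  by_contra h
  rw [if_neg (Ne.symm h)] at key
  omega

end Gleason

lemma FPoly_eq_iterateQuotient {d : ℕ} (hd : 0 < d) {ζ : ℂ} (hζ : IsPrimitiveRoot ζ d) (c : ℂ)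
    (k i : ℕ) : FPoly d c ζ k i = iterateQuotient d c k i := by
  apply mul_right_cancel₀ (fIter_sub_C_monic_natDegree hd c (aSeq d c i) k).1.ne_zero
  rw [iterateQuotient_mul]
  have h := congrArg (fun p => p.comp (fIter d c k))
    (X_pow_sub_C_eq_prod hζ hd (α := aSeq d c i) rfl)
  obtain ⟨e, rfl⟩ := Nat.exists_eq_succ_of_ne_zero hd.ne'
  simp only [sub_comp, pow_comp, X_comp, C_comp, prod_comp] at h
  rw [fIter, aSeq, C_add, add_sub_add_right_eq_sub, h, FPoly, Finset.prod_range_succ', pow_zero,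
    one_mul, Finset.range_eq_Ico,
    Finset.prod_Ico_add' (fun j => fIter (e + 1) c k - C (ζ ^ j * aSeq (e + 1) c i)) 0 e 1]
  congr 2

section NumberField

open NumberField

variable {K : Type*} [Field K] [NumberField K]

lemma exists_unramified_prime {d : ℕ} (hd : d.Prime) {n : ℕ} (hn : 0 < n) {c : 𝓞 K}
    (hgen : Algebra.adjoin ℚ {(c : K)} = ⊤) (hc : aSeq d c n = 0)
    (hc' : ∀ i, 0 < i → i < n → aSeq d c i ≠ 0) :
    ∃ P : Ideal (𝓞 K), P.IsMaximal ∧ (d : 𝓞 K) ∈ P ∧ (d : 𝓞 K) ∉ P ^ 2 ∧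
      ∀ i, 0 < i → i < n → aSeq d c i ∉ P := by
  have hprime : Prime (d : ℤ) := Nat.prime_iff_prime_int.1 hd
  have hpmax : (Ideal.span {(d : ℤ)}).IsMaximal :=
    PrincipalIdealRing.isMaximal_of_irreducible hprime.irreducible
  have hpbot : Ideal.span {(d : ℤ)} ≠ ⊥ := by
    simpa using hd.ne_zero
  obtain ⟨P, hP, hover⟩ := Ideal.exists_maximal_ideal_liesOver_of_isIntegral (S := 𝓞 K)
    (Ideal.span {(d : ℤ)})
  have hdP : (d : 𝓞 K) ∈ P := by
    have := (Ideal.mem_of_liesOver P (Ideal.span {(d : ℤ)}) (d : ℤ)).1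
      (Ideal.mem_span_singleton_self _)
    simpa using this
  obtain ⟨s, hs⟩ := aPoly_derivative (d := d) hn
  have hderiv : aeval c (derivative (aPoly d n)) ∉ P := by
    intro h
    rw [hs] at h
    simp only [map_add, map_one, map_mul, map_natCast] at h
    exact hP.ne_top ((Ideal.eq_top_iff_one _).2
      ((Ideal.add_mem_iff_left P (P.mul_mem_right _ hdP)).1 h))
  have hroot : aeval c (aPoly d n) = 0 := by rw [aeval_aPoly, hc]
  refine ⟨P, hP, hdP, fun hdP2 => hderiv ?_, fun i hi0 hin hi => hderiv ?_⟩
  · have hdvd : P ^ 2 ∣ (Ideal.span {(d : ℤ)}).map (algebraMap ℤ (𝓞 K)) := by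
      rw [Ideal.dvd_iff_le, Ideal.map_span, Ideal.span_le]
      simpa using hdP2
    have hdiff := pow_sub_one_dvd_differentIdeal ℤ P 2 hpbot hdvd
    have hmem := aeval_derivative_mem_differentIdeal ℤ ℚ K c hgen
    have hmemP : aeval c (derivative (minpoly ℤ c)) ∈ P := by
      rw [pow_one, Ideal.dvd_iff_le] at hdiff
      exact hdiff hmem
    obtain ⟨t, ht⟩ := minpoly.isIntegrallyClosed_dvd (RingOfIntegers.isIntegral c) hroot
    rw [ht, derivative_mul, map_add, map_mul, map_mul, minpoly.aeval, zero_mul, add_zero]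
    exact P.mul_mem_right _ hmemP
  · have hg : aSeq d c (i.gcd n) ∈ P := by
      rw [← Ideal.Quotient.eq_zero_iff_mem, map_aSeq, ← isPeriodicPt_zero_iff]
      refine Function.IsPeriodicPt.gcd ?_ ?_
      · rwa [isPeriodicPt_zero_iff, ← map_aSeq, Ideal.Quotient.eq_zero_iff_mem]
      · rw [isPeriodicPt_zero_iff, ← map_aSeq, hc, map_zero]
    have hg0 := hc' (i.gcd n) (Nat.gcd_pos_of_pos_left _ hi0)
      ((Nat.gcd_le_left _ hi0).trans_lt hin)
    obtain ⟨t, ht⟩ := aPoly_dvd (d := d) (Nat.gcd_dvd_right i n)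
    have ht0 : aeval c t = 0 := by
      rw [ht, map_mul, aeval_aPoly] at hroot
      exact (mul_eq_zero.1 hroot).resolve_left hg0
    rw [ht, derivative_mul, map_add, map_mul, map_mul, ht0, mul_zero, zero_add, aeval_aPoly]
    exact P.mul_mem_right _ hg

end NumberField
lemma fIter_factorization {R : Type*} [CommRing R] {d n : ℕ} {c : R} (hn : 0 < n)
    (hd : 0 < d) (hc : aSeq d c n = 0) (q r : ℕ) (hr : r < n) :
    fIter d c (n * q + r) =
      (∏ j ∈ Finset.range q, ∏ i ∈ Finset.Icc 1 (n - 1),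
          iterateQuotient d c (n * q + r - n * j - i) (n - i) ^ d ^ j) *
        ((X - C (aSeq d c (n - r))) *
          ∏ i ∈ Finset.Icc 1 r, iterateQuotient d c (r - i) (n - i)) ^ d ^ q := by
  induction q with
  | zero =>
    have := fIter_sub_C_eq_prod (d := d) c r n r le_rfl hr.le
    rw [hc, C_0, sub_zero, Nat.sub_self, fIter] at this
    simp only [mul_zero, zero_add, Finset.range_zero, Finset.prod_empty, pow_zero, pow_one, one_mul]
    rw [this, mul_comm]
  | succ q ih =>
    have := fIter_sub_C_eq_prod (d := d) c (n * (q + 1) + r) n (n - 1)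
      (by rw [mul_add]; omega) (by omega)
    rw [hc, C_0, sub_zero, show n * (q + 1) + r - (n - 1) = n * q + r + 1 by rw [mul_add]; omega,
      show n - (n - 1) = 0 + 1 by omega, fIter, aSeq, aSeq, zero_pow hd.ne', zero_add,
      add_sub_cancel_right, ih] at this
    rw [this, Finset.prod_range_succ', mul_pow, ← pow_mul, ← pow_succ, ← Finset.prod_pow]
    simp only [← Finset.prod_pow, ← pow_mul, ← pow_succ, mul_zero, Nat.sub_zero, pow_zero, pow_one]
    rw [← mul_assoc, mul_comm (∏ i ∈ Finset.Icc 1 (n - 1), _)]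
    congr 2
    refine Finset.prod_congr rfl fun j _ => Finset.prod_congr rfl fun i _ => ?_
    congr 2
    rw [mul_add, mul_add]
    omega

lemma irreducible_iterateQuotient_adjoin {d : ℕ} (hd : d.Prime) {n : ℕ} (hn : 0 < n) {c₀ : ℂ}
    (hc : aSeq d c₀ n = 0) (hc' : ∀ i, 0 < i → i < n → aSeq d c₀ i ≠ 0) (k : ℕ) {i : ℕ}
    (hi : 0 < i) (hin : i < n) :
    ∃ p : ℚ⟮c₀⟯[X], p.map (algebraMap ℚ⟮c₀⟯ ℂ) = iterateQuotient d c₀ k i ∧ Irreducible p := by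
  have hint : IsIntegral ℤ c₀ := ⟨aPoly d n, aPoly_monic hd.two_le hn, by
    rw [← aeval_def, aeval_aPoly, hc]⟩
  have : FiniteDimensional ℚ ℚ⟮c₀⟯ := adjoin.finiteDimensional hint.tower_top
  have : NumberField ℚ⟮c₀⟯ := ⟨⟩
  have hgen : algebraMap ℚ⟮c₀⟯ ℂ (AdjoinSimple.gen ℚ c₀) = c₀ := AdjoinSimple.algebraMap_gen ℚ c₀
  have hint' : IsIntegral ℤ (AdjoinSimple.gen ℚ c₀) := by
    rw [← isIntegral_algebraMap_iff (algebraMap ℚ⟮c₀⟯ ℂ).injective, hgen]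
    exact hint
  let c : NumberField.RingOfIntegers ℚ⟮c₀⟯ := ⟨AdjoinSimple.gen ℚ c₀, hint'⟩
  let φ := (algebraMap ℚ⟮c₀⟯ ℂ).comp (algebraMap (NumberField.RingOfIntegers ℚ⟮c₀⟯) ℚ⟮c₀⟯)
  have hφ : Function.Injective φ := (algebraMap ℚ⟮c₀⟯ ℂ).injective.comp
    NumberField.RingOfIntegers.coe_injective
  have hφc : φ c = c₀ := hgen
  have hadj : Algebra.adjoin ℚ {(c : ℚ⟮c₀⟯)} = ⊤ := by
    have hint₀ : IsIntegral ℚ c₀ := hint.tower_top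
    have h := (adjoin.powerBasis hint₀).adjoin_gen_eq_top
    rwa [adjoin.powerBasis_gen] at h
  obtain ⟨P, hP, hdP, hdP2, hiP⟩ := exists_unramified_prime hd hn hadj
    (hφ (by rw [map_aSeq, hφc, hc, map_zero]))
    (fun i h0 hi h => hc' i h0 hi (by rw [← hφc, ← map_aSeq, h, map_zero]))
  have : Fact d.Prime := ⟨hd⟩
  have hirr := iterateQuotient_irreducible hdP hdP2 hn
    (hφ (by rw [map_aSeq, hφc, hc, map_zero])) (hiP i hi hin) k
  refine ⟨(iterateQuotient d c k i).map (algebraMap _ ℚ⟮c₀⟯), ?_, ?_⟩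
  · rw [Polynomial.map_map, map_iterateQuotient]
    exact congrArg (iterateQuotient d · k i) hφc
  · exact (iterateQuotient_monic_natDegree hd.pos c k i).1
      |>.irreducible_iff_irreducible_map_fraction_map.1 hirr

lemma nodup_factor_indices (n k q r : ℕ) (hr : r < n) (hk : k = n * q + r) :
    (((Finset.range q ×ˢ Finset.Icc 1 (n - 1)).val.map (fun p => k - n * p.1 - p.2)) +
      (Finset.Icc 1 r).val.map (fun i => r - i)).Nodup := by
  have hlt : ∀ j i, j < q → i ≤ n - 1 → n * j + i + r < k := fun j i hj hi => by
    have : n * (j + 1) ≤ n * q := Nat.mul_le_mul_left n hj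
    rw [mul_add] at this
    omega
  rw [Multiset.nodup_add]
  refine ⟨Multiset.Nodup.map_on ?_ (Finset.nodup _), Multiset.Nodup.map_on ?_ (Finset.nodup _), ?_⟩
  · rintro ⟨j, i⟩ h ⟨j', i'⟩ h' heq
    simp only [Finset.mem_val, Finset.mem_product, Finset.mem_range, Finset.mem_Icc] at h h' heq
    have h1 := hlt j i h.1 h.2.2
    have h2 := hlt j' i' h'.1 h'.2.2
    have h3 : n * j + i = n * j' + i' := by omega
    have h4 : ∀ a b, b ≤ n - 1 → (n * a + b) / n = a := fun a b hb => by
      rw [Nat.mul_add_div (by omega), Nat.div_eq_of_lt (by omega), add_zero]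
    have h5 : j = j' := by rw [← h4 j i h.2.2, h3, h4 j' i' h'.2.2]
    subst h5
    simp only [Prod.mk.injEq, true_and]
    omega
  · intro i hi i' hi' heq
    simp only [Finset.mem_val, Finset.mem_Icc] at hi hi'
    omega
  · rw [Multiset.disjoint_left]
    intro x hx hx'
    simp only [Multiset.mem_map, Finset.mem_val, Finset.mem_product, Finset.mem_range,
      Finset.mem_Icc, Prod.exists] at hx hx'
    obtain ⟨j, i, ⟨hj, hi⟩, rfl⟩ := hx
    obtain ⟨i', hi', h⟩ := hx'
    have := hlt j i hj hi.2
    omega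

/-- Complete factorization of `f_{d,c₀}^k` over `K = ℚ(c₀)` for a Gleason
parameter `c₀` of period `n ≥ 2`: writing `k = nq + r`, the iterate factors as in
Theorem 1.5(b), the `F_{a,b}` appearing are pairwise distinct, and each one is (defined and)
irreducible over `K`. -/
theorem stmt2 (d : ℕ) (hd : Nat.Prime d) (n : ℕ) (hn : 2 ≤ n)
    (c₀ : ℂ) (hc₀ : isGleasonRoot d n c₀)
    (ζ : ℂ) (hζ : IsPrimitiveRoot ζ d)
    (k : ℕ) (hk : 1 ≤ k) (q r : ℕ) (hr : r < n) (hkqr : k = n * q + r) :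
    fIter d c₀ k =
      (∏ j ∈ Finset.range q, ∏ i ∈ Finset.Icc 1 (n - 1),
          FPoly d c₀ ζ (k - n * j - i) (n - i) ^ d ^ j) *
        ((X - C (aSeq d c₀ (n - r))) *
          ∏ i ∈ Finset.Icc 1 r, FPoly d c₀ ζ (r - i) (n - i)) ^ d ^ q
    ∧ (((Finset.range q ×ˢ Finset.Icc 1 (n - 1)).val.map
          (fun p => (k - n * p.1 - p.2, n - p.2)) +
        (Finset.Icc 1 r).val.map (fun i => (r - i, n - i))).map
          (fun p => FPoly d c₀ ζ p.1 p.2)).Nodup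
    ∧ ∀ p ∈ (Finset.range q ×ˢ Finset.Icc 1 (n - 1)).val.map
          (fun p => (k - n * p.1 - p.2, n - p.2)) +
        (Finset.Icc 1 r).val.map (fun i => (r - i, n - i)),
        ∃ pK : Polynomial ℚ⟮c₀⟯,
          pK.map (algebraMap ℚ⟮c₀⟯ ℂ) = FPoly d c₀ ζ p.1 p.2 ∧ Irreducible pK := by
  have hc0 := minimalPeriod_of_isGleasonRoot hd.two_le (by omega) hc₀
  have hc : aSeq d c₀ n = 0 := by
    rw [← isPeriodicPt_zero_iff, Function.isPeriodicPt_iff_minimalPeriod_dvd, hc0]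
  have hc' : ∀ i, 0 < i → i < n → aSeq d c₀ i ≠ 0 := fun i h0 hi h => by
    rw [← isPeriodicPt_zero_iff, Function.isPeriodicPt_iff_minimalPeriod_dvd, hc0] at h
    exact absurd (Nat.le_of_dvd h0 h) (by omega)
  simp only [FPoly_eq_iterateQuotient hd.pos hζ]
  refine ⟨?_, ?_, ?_⟩
  · rw [hkqr]
    exact fIter_factorization (by omega) hd.pos hc q r hr
  · apply Multiset.Nodup.of_map natDegree
    have hinj : Function.Injective fun a => (d - 1) * d ^ a := fun a b hab =>
      Nat.pow_right_injective hd.two_le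
        (Nat.eq_of_mul_eq_mul_left (Nat.sub_pos_of_lt hd.one_lt) hab)
    have := (nodup_factor_indices n k q r hr hkqr).map hinj
    simpa [Multiset.map_map, Function.comp_def,
      fun a b => (iterateQuotient_monic_natDegree hd.pos c₀ a b).2] using this
  · intro p hp
    have hp2 : 0 < p.2 ∧ p.2 < n := by
      simp only [Multiset.mem_add, Multiset.mem_map, Finset.mem_val, Finset.mem_product,
        Finset.mem_Icc] at hp
      rcases hp with ⟨x, hx, rfl⟩ | ⟨x, hx, rfl⟩ <;> dsimp only <;> omega
    exact irreducible_iterateQuotient_adjoin hd (by omega) hc hc' p.1 hp2.1 hp2.2
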